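/- arXiv:2402.06968 — 3 statements merged into one kernel-verified Lean document; each statement's English description precedes it below -/
import Mathlib

section
/- Let θ = (v_1, ..., v_{L_0}) be a route ending at customer i, with reduced cost C̄_θ and load q_θ ≤ Q, and suppose each scenario travel time t^ω is nonnegative. Let δ ∈ ℝ with δ ≤ τ_θ, and let T̂ : {1, ..., N} × ℝ → ℝ be a function satisfying: (i) for all customers j and m with m ≠ j and all r ∈ ℝ with q(m) ≤ r, T̂(j, r) ≤ −c(j, 0) + c(j, m) + c(m, 0) + π(δ − ℓ(m)) − γ(m) + T̂(m, r − q(m)); and (ii) T̂(j, r) ≤ 0 for all customers j and all r ≥ 0. Then for every extension θ' = θ ⊕ (u_1, ..., u_L), where u_1, ..., u_L are pairwise distinct customers none of which occurs in θ and q_{θ'} ≤ Q, the following holds: if C̄_θ + T̂(i, Q − q_θ) ≥ 0, then C̄_{θ'} ≥ 0. (Proposition 1: validity of the resource-constrained shortest path completion bound for label elimination.) -/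
open Finset

namespace CSVRPTW

/-- The node set `V = {0, 1, …, N}`: node `0` is the depot, `1, …, N` are customers. -/
abbrev V (N : ℕ) := Fin (N + 1)

variable {N : ℕ} {Ω : Type*} [Fintype Ω] [Nonempty Ω]

/-- Helper for the arrival-time recursion: `p` is the previous node and `ap` the arrival
time at `p`; returns the arrival time at the last node of the remaining list
(or `ap` if the list is empty). -/
def arrGo (t : V N → V N → ℝ) (e : V N → ℝ) : V N → ℝ → List (V N) → ℝ
  | _, ap, [] => ap
  | p, ap, v :: rest => arrGo t e v (max (e p) ap + t p v) rest

/-- Arrival time at the last node of a route (junk value `0` for the empty list):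
`a_θ(v₁; t) = t(0, v₁)` and `a_θ(v_k; t) = max (e v_{k-1}) (a_θ(v_{k-1}; t)) + t v_{k-1} v_k`. -/
def arrLast (t : V N → V N → ℝ) (e : V N → ℝ) : List (V N) → ℝ
  | [] => 0
  | v :: rest => arrGo t e v (t 0 v) rest

/-- Arrival time `a_θ(v_{k+1}; t)` at the node in (0-indexed) position `k` of `θ`. -/
def arr (t : V N → V N → ℝ) (e : V N → ℝ) (θ : List (V N)) (k : ℕ) : ℝ :=
  arrLast t e (θ.take (k + 1))

/-- Service start time `s_θ(v_{k+1}; t)` at the node in (0-indexed) position `k` of `θ`. -/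
def srv (t : V N → V N → ℝ) (e : V N → ℝ) (θ : List (V N)) (k : ℕ) : ℝ :=
  max (e (θ.getD k 0)) (arr t e θ k)

/-- Service start time at the last node of a route. -/
def srvLast (t : V N → V N → ℝ) (e : V N → ℝ) (θ : List (V N)) : ℝ :=
  max (e (θ.getLastD 0)) (arrLast t e θ)

/-- Earliest service start time `τ_θ = min_{ω ∈ Ω} s_θ(i; t^ω)` of a route `θ`
ending at its last customer. -/
def tau (tw : Ω → V N → V N → ℝ) (e : V N → ℝ) (θ : List (V N)) : ℝ :=
  univ.inf' univ_nonempty fun ω => srvLast (tw ω) e θ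

/-- Helper: cost of the path starting at `p`, visiting the list in order,
and returning to the depot. -/
def costGo (c : V N → V N → ℝ) : V N → List (V N) → ℝ
  | p, [] => c p 0
  | p, v :: rest => c p v + costGo c v rest

/-- Transportation cost `C_θ = c(0,v₁) + Σ_{k=2}^L c(v_{k-1},v_k) + c(v_L,0)` of a route. -/
def cost (c : V N → V N → ℝ) : List (V N) → ℝ
  | [] => 0
  | v :: rest => c 0 v + costGo c v rest

/-- Load `q_θ = Σ_{k=1}^L q(v_k)` of a route. -/
def load (q : V N → ℝ) (θ : List (V N)) : ℝ := (θ.map q).sum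

/-- Total late-arrival penalty `Σ_{k=1}^L π(a_θ(v_k; t) − ℓ(v_k))` of route `θ`
under travel times `t`. -/
def penaltySum (π : ℝ → ℝ) (ℓ : V N → ℝ) (t : V N → V N → ℝ) (e : V N → ℝ)
    (θ : List (V N)) : ℝ :=
  ∑ k : Fin θ.length, π (arr t e θ k.val - ℓ (θ.get k))

/-- Reduced cost
`C̄_θ = C_θ + Σ_ω α^ω Σ_k π(a_θ(v_k; t^ω) − ℓ(v_k)) − Σ_k γ(v_k) − μ` of a route. -/
def redCost (c : V N → V N → ℝ) (π : ℝ → ℝ) (ℓ γ : V N → ℝ) (μ : ℝ)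
    (α : Ω → ℝ) (tw : Ω → V N → V N → ℝ) (e : V N → ℝ) (θ : List (V N)) : ℝ :=
  cost c θ + (∑ ω : Ω, α ω * penaltySum π ℓ (tw ω) e θ)
    - (∑ k : Fin θ.length, γ (θ.get k)) - μ

/-- A route: a nonempty list of pairwise distinct customers. -/
def IsRoute (θ : List (V N)) : Prop := θ ≠ [] ∧ θ.Nodup ∧ ∀ v ∈ θ, v ≠ 0

/-- `d` satisfies the triangle inequality. -/
def Triangle (d : V N → V N → ℝ) : Prop := ∀ u v w, d u w ≤ d u v + d v w

theorem sum_fin_get_concat (f : ℕ → V N → ℝ) (l : List (V N)) (m : V N) :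
    ∑ k : Fin (l ++ [m]).length, f k.val ((l ++ [m]).get k) =
      (∑ k : Fin l.length, f k.val (l.get k)) + f l.length m := by
  have sum_getD : ∀ l : List (V N), ∑ k : Fin l.length, f k.val (l.get k) =
      ∑ k ∈ range l.length, f k (l.getD k 0) := by
    intro l
    rw [Finset.sum_range]
    exact Finset.sum_congr rfl fun k _ => by simp
  rw [sum_getD, sum_getD, List.length_append, List.length_singleton, Finset.sum_range_succ]
  congr 1
  · refine Finset.sum_congr rfl fun k hk => ?_
    rw [List.getD_append _ _ _ _ (Finset.mem_range.mp hk)]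
  · simp

theorem arrGo_concat (t : V N → V N → ℝ) (e : V N → ℝ) (m : V N) (l : List (V N)) :
    ∀ (p : V N) (a : ℝ), arrGo t e p a (l ++ [m]) =
      max (e (l.getLastD p)) (arrGo t e p a l) + t (l.getLastD p) m := by
  induction l with
  | nil => intro p a; rfl
  | cons v l ih => intro p a; simpa only [List.cons_append, arrGo, List.getLastD_cons] using ih v _

theorem arrLast_concat (t : V N → V N → ℝ) (e : V N → ℝ) (m : V N) {θ : List (V N)}
    (hθ : θ ≠ []) : arrLast t e (θ ++ [m]) = srvLast t e θ + t (θ.getLastD 0) m := by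
  obtain ⟨v, l, rfl⟩ := List.exists_cons_of_ne_nil hθ
  simpa only [List.cons_append, arrLast, srvLast, List.getLastD_cons] using
    arrGo_concat t e m l v _

theorem costGo_concat (c : V N → V N → ℝ) (m : V N) (l : List (V N)) :
    ∀ p : V N, costGo c p (l ++ [m]) =
      costGo c p l - c (l.getLastD p) 0 + c (l.getLastD p) m + c m 0 := by
  induction l with
  | nil => intro p; simp [costGo]
  | cons v l ih =>
    intro p
    simp only [List.cons_append, costGo, List.getLastD_cons, ih v]
    ring

theorem cost_concat (c : V N → V N → ℝ) (m : V N) {θ : List (V N)} (hθ : θ ≠ []) :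
    cost c (θ ++ [m]) =
      cost c θ - c (θ.getLastD 0) 0 + c (θ.getLastD 0) m + c m 0 := by
  obtain ⟨v, l, rfl⟩ := List.exists_cons_of_ne_nil hθ
  simp only [List.cons_append, cost, List.getLastD_cons, costGo_concat]
  ring

theorem load_concat (q : V N → ℝ) (θ : List (V N)) (m : V N) :
    load q (θ ++ [m]) = load q θ + q m := by
  simp [load]

theorem load_le_load_append {q : V N → ℝ} (hq : ∀ v, 0 ≤ q v) (θ us : List (V N)) :
    load q θ ≤ load q (θ ++ us) := by
  have h : 0 ≤ (us.map q).sum := List.sum_nonneg (by simpa using fun v _ => hq v)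
  simpa [load] using h

theorem penaltySum_concat (π : ℝ → ℝ) (ℓ : V N → ℝ) (t : V N → V N → ℝ) (e : V N → ℝ)
    (θ : List (V N)) (m : V N) :
    penaltySum π ℓ t e (θ ++ [m]) =
      penaltySum π ℓ t e θ + π (arrLast t e (θ ++ [m]) - ℓ m) := by
  unfold penaltySum
  rw [sum_fin_get_concat (fun k v => π (arr t e (θ ++ [m]) k - ℓ v))]
  congr 1
  · refine Finset.sum_congr rfl fun k _ => ?_
    simp only [arr]
    rw [List.take_append_of_le_length k.isLt]
  · simp only [arr]
    rw [List.take_of_length_le (by simp)]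

theorem tau_le_arrLast_concat {tw : Ω → V N → V N → ℝ} (htw : ∀ ω u v, 0 ≤ tw ω u v)
    (e : V N → ℝ) (m : V N) {θ : List (V N)} (hθ : θ ≠ []) (ω : Ω) :
    tau tw e θ ≤ arrLast (tw ω) e (θ ++ [m]) := by
  rw [arrLast_concat _ _ _ hθ]
  exact (Finset.inf'_le _ (mem_univ ω)).trans (le_add_of_nonneg_right (htw ω _ _))

theorem tau_le_tau_concat {tw : Ω → V N → V N → ℝ} (htw : ∀ ω u v, 0 ≤ tw ω u v)
    (e : V N → ℝ) (m : V N) {θ : List (V N)} (hθ : θ ≠ []) :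
    tau tw e θ ≤ tau tw e (θ ++ [m]) :=
  Finset.le_inf' _ _ fun ω _ =>
    (tau_le_arrLast_concat htw e m hθ ω).trans (le_max_right _ _)

theorem redCost_concat_ge (c : V N → V N → ℝ) {π : ℝ → ℝ} (hπ : Monotone π)
    (ℓ γ : V N → ℝ) (μ : ℝ) {α : Ω → ℝ} (hα : ∀ ω, 0 ≤ α ω) (hαsum : ∑ ω, α ω = 1)
    {tw : Ω → V N → V N → ℝ} (htw : ∀ ω u v, 0 ≤ tw ω u v) (e : V N → ℝ)
    {θ : List (V N)} (hθ : θ ≠ []) {δ : ℝ} (hδ : δ ≤ tau tw e θ) (m : V N) :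
    redCost c π ℓ γ μ α tw e θ + (-c (θ.getLastD 0) 0 + c (θ.getLastD 0) m + c m 0
      + π (δ - ℓ m) - γ m) ≤ redCost c π ℓ γ μ α tw e (θ ++ [m]) := by
  have hpen : (∑ ω, α ω * penaltySum π ℓ (tw ω) e θ) + π (δ - ℓ m) ≤
      ∑ ω, α ω * penaltySum π ℓ (tw ω) e (θ ++ [m]) := by
    have hsplit : π (δ - ℓ m) = ∑ ω, α ω * π (δ - ℓ m) := by
      rw [← Finset.sum_mul, hαsum, one_mul]
    rw [hsplit, ← Finset.sum_add_distrib]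
    refine Finset.sum_le_sum fun ω _ => ?_
    rw [penaltySum_concat, mul_add]
    have hm : π (δ - ℓ m) ≤ π (arrLast (tw ω) e (θ ++ [m]) - ℓ m) :=
      hπ (sub_le_sub_right (hδ.trans (tau_le_arrLast_concat htw e m hθ ω)) _)
    linarith [mul_le_mul_of_nonneg_left hm (hα ω)]
  unfold redCost
  rw [cost_concat c m hθ, sum_fin_get_concat fun _ v => γ v]
  linarith

theorem redCost_append_ge (c : V N → V N → ℝ) {π : ℝ → ℝ} (hπ : Monotone π)
    (e ℓ γ : V N → ℝ) {q : V N → ℝ} (μ : ℝ) {Q δ : ℝ} {α : Ω → ℝ}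
    {tw : Ω → V N → V N → ℝ} (hα : ∀ ω, 0 ≤ α ω) (hαsum : ∑ ω, α ω = 1)
    (hq : ∀ v, 0 ≤ q v) (htw : ∀ ω u v, 0 ≤ tw ω u v) {T : V N → ℝ → ℝ}
    (hT1 : ∀ j m : V N, j ≠ 0 → m ≠ 0 → m ≠ j → ∀ r : ℝ, q m ≤ r →
      T j r ≤ -c j 0 + c j m + c m 0 + π (δ - ℓ m) - γ m + T m (r - q m))
    (hT2 : ∀ j : V N, j ≠ 0 → ∀ r : ℝ, 0 ≤ r → T j r ≤ 0) (us : List (V N)) :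
    ∀ θ : List (V N), θ.getLastD 0 ≠ 0 → δ ≤ tau tw e θ → us.Nodup → (∀ u ∈ us, u ≠ 0) →
      (∀ u ∈ us, u ∉ θ) → load q (θ ++ us) ≤ Q →
      redCost c π ℓ γ μ α tw e θ + T (θ.getLastD 0) (Q - load q θ) ≤
        redCost c π ℓ γ μ α tw e (θ ++ us) := by
  induction us with
  | nil =>
    intro θ h0 _ _ _ _ hload
    rw [List.append_nil] at hload ⊢
    linarith [hT2 _ h0 (Q - load q θ) (sub_nonneg.mpr hload)]
  | cons m us ih =>
    intro θ h0 hδ hnd hcust hdisj hload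
    have hθ : θ ≠ [] := by rintro rfl; exact h0 rfl
    have hm0 : m ≠ 0 := hcust m List.mem_cons_self
    have hlast : (θ ++ [m]).getLastD 0 = m := by simp
    have hlast_mem : θ.getLastD 0 ∈ θ := by
      rw [List.getLastD_eq_getLast?, List.getLast?_eq_some_getLast hθ]
      exact List.getLast_mem hθ
    have hne : m ≠ θ.getLastD 0 := fun h =>
      hdisj m List.mem_cons_self (by rw [h]; exact hlast_mem)
    rw [List.append_cons] at hload ⊢
    have hle := (load_le_load_append hq (θ ++ [m]) us).trans hload
    rw [load_concat] at hle
    have hrec := ih (θ ++ [m]) (by rwa [hlast]) (hδ.trans (tau_le_tau_concat htw e m hθ))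
      hnd.of_cons (fun u hu => hcust u (List.mem_cons_of_mem _ hu))
      (fun u hu hmem => by
        rcases List.mem_append.mp hmem with h | h
        · exact hdisj u (List.mem_cons_of_mem _ hu) h
        · rw [List.mem_singleton] at h
          exact (List.nodup_cons.mp hnd).1 (h ▸ hu)) hload
    rw [hlast, load_concat, ← sub_sub] at hrec
    have hstep := redCost_concat_ge c hπ ℓ γ μ hα hαsum htw e hθ hδ m
    have hT := hT1 _ m h0 hm0 hne (Q - load q θ) (by linarith)
    linarith

/-- **Proposition 1** (validity of the RCSP completion bound for label elimination).
If `θ` is a route ending at customer `i` with load at most `Q`, scenario travel times are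
nonnegative, `δ ≤ τ_θ`, and `T̂` satisfies the two recursive lower-bound conditions, then
for every extension `θ' = θ ⊕ (u₁, …, u_L)` by pairwise distinct customers not occurring
in `θ` with `q_{θ'} ≤ Q`: if `C̄_θ + T̂(i, Q − q_θ) ≥ 0` then `C̄_{θ'} ≥ 0`. -/
theorem prop1_rcsp_completion_bound
    {N : ℕ} {Ω : Type*} [Fintype Ω] [Nonempty Ω]
    (c : V N → V N → ℝ) (π : ℝ → ℝ) (e ℓ γ q : V N → ℝ) (μ Q δ : ℝ)
    (α : Ω → ℝ) (tw : Ω → V N → V N → ℝ)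
    (hπmono : Monotone π) (hπzero : ∀ u : ℝ, u ≤ 0 → π u = 0)
    (hα : ∀ ω : Ω, 0 ≤ α ω) (hαsum : ∑ ω : Ω, α ω = 1)
    (hq : ∀ v : V N, 0 ≤ q v)
    (htw : ∀ (ω : Ω) (u v : V N), 0 ≤ tw ω u v)
    (θ : List (V N)) (i : V N)
    (hθ : IsRoute θ) (hi : i ≠ 0) (hlast : θ.getLastD 0 = i)
    (hload : load q θ ≤ Q)
    (hδ : δ ≤ tau tw e θ)
    (T : V N → ℝ → ℝ)
    (hT1 : ∀ j m : V N, j ≠ 0 → m ≠ 0 → m ≠ j → ∀ r : ℝ, q m ≤ r →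
      T j r ≤ -c j 0 + c j m + c m 0 + π (δ - ℓ m) - γ m + T m (r - q m))
    (hT2 : ∀ j : V N, j ≠ 0 → ∀ r : ℝ, 0 ≤ r → T j r ≤ 0)
    (us : List (V N)) (hus : us ≠ []) (husnd : us.Nodup)
    (huscust : ∀ u ∈ us, u ≠ 0) (husdisj : ∀ u ∈ us, u ∉ θ)
    (hload' : load q (θ ++ us) ≤ Q)
    (hbound : 0 ≤ redCost c π ℓ γ μ α tw e θ + T i (Q - load q θ)) :
    0 ≤ redCost c π ℓ γ μ α tw e (θ ++ us) := by
  subst hlast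
  exact hbound.trans (redCost_append_ge c hπmono e ℓ γ μ hα hαsum hq htw hT1 hT2 us θ hi hδ
    husnd huscust husdisj hload')

end CSVRPTW
end

section
/- Let θ be a route ending at customer i with reduced cost C̄_θ and load q_θ ≤ Q. Assume the arc costs c satisfy the triangle inequality, and assume each scenario travel time t^ω is nonnegative and satisfies the triangle inequality. For each customer j, define the knapsack value v_j = γ(j) − π(τ_θ + min_{ω∈Ω} t^ω(i, j) − ℓ(j)). Call z : {1, ..., N} → ℝ feasible if 0 ≤ z_j ≤ 1 for all j, z_j = 0 whenever j occurs in θ, and Σ_{j=1}^{N} q(j) z_j ≤ Q − q_θ. Let z̄ be a feasible solution that is optimal for the linear relaxation, i.e., Σ_{j=1}^{N} v_j z̄_j ≥ Σ_{j=1}^{N} v_j z_j for every feasible z, and set T̂_ks = −Σ_{j=1}^{N} v_j z̄_j. Then for every extension θ' = θ ⊕ (u_1, ..., u_L), where u_1, ..., u_L are pairwise distinct customers none of which occurs in θ and q_{θ'} ≤ Q, the following holds: if C̄_θ + T̂_ks ≥ 0, then C̄_{θ'} ≥ 0. (Proposition 2: validity of the knapsack completion bound for label elimination.) -/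
open Finset

namespace CSVRPTW

variable {N : ℕ} {Ω : Type*} [Fintype Ω] [Nonempty Ω]

/-- Arrival times along a concatenation restart from the last node of the first part. -/
theorem arrGo_append (t : V N → V N → ℝ) (e : V N → ℝ) (l₁ l₂ : List (V N)) (p : V N) (ap : ℝ) :
    arrGo t e p ap (l₁ ++ l₂) = arrGo t e (l₁.getLastD p) (arrGo t e p ap l₁) l₂ := by
  induction l₁ generalizing p ap with
  | nil => rfl
  | cons v rest ih =>
    rw [List.cons_append, arrGo, ih, arrGo, List.getLastD_cons]

theorem arrLast_append (t : V N → V N → ℝ) (e : V N → ℝ) {θ : List (V N)} (hθ : θ ≠ [])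
    (l : List (V N)) :
    arrLast t e (θ ++ l) = arrGo t e (θ.getLastD 0) (arrLast t e θ) l := by
  cases θ with
  | nil => exact absurd rfl hθ
  | cons v rest =>
    rw [List.cons_append, arrLast, arrGo_append, arrLast, List.getLastD_cons]

/-- If every node is reached from `p` no earlier than directly from `i` when leaving at time `S`,
then this also holds for the last node of any path leaving `p`. -/
theorem add_le_arrGo {t : V N → V N → ℝ} (ht : Triangle t) (e : V N → ℝ) {i : V N} {S : ℝ}
    (l : List (V N)) (hl : l ≠ []) (p : V N) (ap : ℝ)
    (h : ∀ w, S + t i w ≤ max (e p) ap + t p w) :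
    S + t i (l.getLast hl) ≤ arrGo t e p ap l := by
  induction l generalizing p ap with
  | nil => exact absurd rfl hl
  | cons v rest ih =>
    rw [arrGo]
    rcases eq_or_ne rest [] with rfl | hr
    · exact h v
    · rw [List.getLast_cons hr]
      refine ih hr _ _ fun w => ?_
      linarith [h v, ht i v w, le_max_right (e v) (max (e p) ap + t p v)]

theorem arr_append_left (t : V N → V N → ℝ) (e : V N → ℝ) {θ : List (V N)} (us : List (V N))
    {k : ℕ} (hk : k < θ.length) : arr t e (θ ++ us) k = arr t e θ k := by
  rw [arr, arr, List.take_append_of_le_length hk]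

/-- A customer of an extension is reached no earlier than directly from the last customer. -/
theorem srvLast_add_le_arr_append {t : V N → V N → ℝ} (ht : Triangle t) (e : V N → ℝ)
    {θ : List (V N)} (hθ : θ ≠ []) {us : List (V N)} {k : ℕ} (hk : k < us.length) :
    srvLast t e θ + t (θ.getLastD 0) us[k] ≤ arr t e (θ ++ us) (θ.length + k) := by
  have htake : us.take (k + 1) ≠ [] := by
    rw [← List.length_pos_iff, List.length_take]
    omega
  have hlast : (us.take (k + 1)).getLast htake = us[k] := by
    simp [List.getLast_eq_getElem, Nat.min_eq_left (Nat.succ_le_of_lt hk)]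
  rw [arr, add_assoc, List.take_length_add_append, arrLast_append t e hθ, ← hlast]
  exact add_le_arrGo ht e _ htake _ _ fun w => le_rfl

theorem penaltySum_eq_sum_range (π : ℝ → ℝ) (ℓ : V N → ℝ) (t : V N → V N → ℝ) (e : V N → ℝ)
    (θ : List (V N)) :
    penaltySum π ℓ t e θ = ∑ k ∈ range θ.length, π (arr t e θ k - ℓ (θ.getD k 0)) := by
  rw [penaltySum, Finset.sum_range]
  exact Finset.sum_congr rfl fun k _ => by simp

theorem sum_map_eq_sum_range (f : V N → ℝ) (l : List (V N)) :
    (l.map f).sum = ∑ k ∈ range l.length, f (l.getD k 0) := by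
  rw [Finset.sum_range, ← Fin.sum_univ_fun_getElem]
  exact Finset.sum_congr rfl fun k _ => by simp

/-- An extension adds at least the penalties computed from a lower bound `b` on the arrival
times at the appended customers. -/
theorem penaltySum_append_ge {π : ℝ → ℝ} (hπ : Monotone π) (ℓ : V N → ℝ) {t : V N → V N → ℝ}
    (ht : Triangle t) (e : V N → ℝ) {θ : List (V N)} (hθ : θ ≠ []) (us : List (V N))
    {b : V N → ℝ} (hb : ∀ j, b j ≤ srvLast t e θ + t (θ.getLastD 0) j) :
    penaltySum π ℓ t e θ + (us.map fun j => π (b j - ℓ j)).sum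
      ≤ penaltySum π ℓ t e (θ ++ us) := by
  rw [penaltySum_eq_sum_range, penaltySum_eq_sum_range, sum_map_eq_sum_range, List.length_append,
    Finset.sum_range_add]
  refine add_le_add (Finset.sum_le_sum fun k hk => ?_) (Finset.sum_le_sum fun k hk => ?_)
  · have hk' := Finset.mem_range.1 hk
    rw [arr_append_left t e us hk', List.getD_append _ _ _ _ hk']
  · have hk' := Finset.mem_range.1 hk
    rw [List.getD_append_right _ _ _ _ (Nat.le_add_right _ _), Nat.add_sub_cancel_left,
      List.getD_eq_getElem _ _ hk']
    exact hπ (sub_le_sub_right ((hb _).trans (srvLast_add_le_arr_append ht e hθ hk')) _)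

theorem le_costGo {c : V N → V N → ℝ} (hc : Triangle c) (p : V N) (l : List (V N)) :
    c p 0 ≤ costGo c p l := by
  induction l generalizing p with
  | nil => exact le_rfl
  | cons v rest ih =>
    rw [costGo]
    linarith [ih v, hc p v 0]

theorem costGo_le_costGo_append {c : V N → V N → ℝ} (hc : Triangle c) (p : V N)
    (l us : List (V N)) : costGo c p l ≤ costGo c p (l ++ us) := by
  induction l generalizing p with
  | nil => exact le_costGo hc p us
  | cons v rest ih =>
    rw [List.cons_append, costGo, costGo]
    linarith [ih v]

theorem cost_le_cost_append {c : V N → V N → ℝ} (hc : Triangle c) {θ : List (V N)}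
    (hθ : θ ≠ []) (us : List (V N)) : cost c θ ≤ cost c (θ ++ us) := by
  cases θ with
  | nil => exact absurd rfl hθ
  | cons v rest =>
    rw [List.cons_append, cost, cost]
    linarith [costGo_le_costGo_append hc v rest us]

/-- Summing against the indicator of a duplicate-free list of customers. -/
theorem sum_erase_zero_mul_indicator (f : V N → ℝ) {us : List (V N)} (hnd : us.Nodup)
    (hne : ∀ u ∈ us, u ≠ 0) :
    ∑ j ∈ univ.erase (0 : V N), f j * (if j ∈ us then 1 else 0) = (us.map f).sum := by
  rw [← List.sum_toFinset f hnd]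
  simp only [mul_ite, mul_one, mul_zero]
  rw [← Finset.sum_filter]
  refine Finset.sum_congr ?_ fun _ _ => rfl
  ext j
  simp only [mem_filter, mem_erase, mem_univ, and_true, List.mem_toFinset]
  exact ⟨fun h => h.2, fun h => ⟨hne j h, h⟩⟩

/-- **Proposition 2** (validity of the knapsack completion bound for label elimination).
Under the triangle inequality for costs and for each nonnegative scenario travel time,
if `z̄` is an optimal solution of the linear relaxation of the knapsack problem with
values `kv j = γ(j) − π(τ_θ + min_ω t^ω(i,j) − ℓ(j))` and `T̂_ks = −Σ_j kv j z̄_j`, then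
for every extension `θ' = θ ⊕ (u₁, …, u_L)` by pairwise distinct customers not occurring
in `θ` with `q_{θ'} ≤ Q`: if `C̄_θ + T̂_ks ≥ 0` then `C̄_{θ'} ≥ 0`. -/
theorem prop2_knapsack_completion_bound
    {N : ℕ} {Ω : Type*} [Fintype Ω] [Nonempty Ω]
    (c : V N → V N → ℝ) (π : ℝ → ℝ) (e ℓ γ q : V N → ℝ) (μ Q : ℝ)
    (α : Ω → ℝ) (tw : Ω → V N → V N → ℝ)
    (hc : Triangle c)
    (hπmono : Monotone π) (hπzero : ∀ u : ℝ, u ≤ 0 → π u = 0)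
    (hα : ∀ ω : Ω, 0 ≤ α ω) (hαsum : ∑ ω : Ω, α ω = 1)
    (hq : ∀ v : V N, 0 ≤ q v)
    (htw : ∀ (ω : Ω) (u v : V N), 0 ≤ tw ω u v)
    (htwtri : ∀ ω : Ω, Triangle (tw ω))
    (θ : List (V N)) (i : V N)
    (hθ : IsRoute θ) (hi : i ≠ 0) (hlast : θ.getLastD 0 = i)
    (hload : load q θ ≤ Q)
    (kv : V N → ℝ)
    (hkv : ∀ j : V N, kv j =
      γ j - π (tau tw e θ + (univ.inf' univ_nonempty fun ω => tw ω i j) - ℓ j))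
    (zbar : V N → ℝ)
    (hzbar01 : ∀ j : V N, j ≠ 0 → 0 ≤ zbar j ∧ zbar j ≤ 1)
    (hzbarθ : ∀ j ∈ θ, zbar j = 0)
    (hzbarcap : ∑ j ∈ univ.erase (0 : V N), q j * zbar j ≤ Q - load q θ)
    (hzbaropt : ∀ z : V N → ℝ, (∀ j : V N, j ≠ 0 → 0 ≤ z j ∧ z j ≤ 1) →
      (∀ j ∈ θ, z j = 0) → (∑ j ∈ univ.erase (0 : V N), q j * z j ≤ Q - load q θ) →
      ∑ j ∈ univ.erase (0 : V N), kv j * z j ≤ ∑ j ∈ univ.erase (0 : V N), kv j * zbar j)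
    (us : List (V N)) (hus : us ≠ []) (husnd : us.Nodup)
    (huscust : ∀ u ∈ us, u ≠ 0) (husdisj : ∀ u ∈ us, u ∉ θ)
    (hload' : load q (θ ++ us) ≤ Q)
    (hbound : 0 ≤ redCost c π ℓ γ μ α tw e θ
      + (-∑ j ∈ univ.erase (0 : V N), kv j * zbar j)) :
    0 ≤ redCost c π ℓ γ μ α tw e (θ ++ us) := by
  have hθ' := hθ.1
  set b : V N → ℝ := fun j => tau tw e θ + univ.inf' univ_nonempty fun ω => tw ω i j with hb
  have hpen : ∀ ω, penaltySum π ℓ (tw ω) e θ + (us.map fun j => π (b j - ℓ j)).sum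
      ≤ penaltySum π ℓ (tw ω) e (θ ++ us) := fun ω =>
    penaltySum_append_ge hπmono ℓ (htwtri ω) e hθ' us fun j => by
      rw [hlast]
      exact add_le_add (Finset.inf'_le _ (mem_univ ω))
        (Finset.inf'_le (fun ω => tw ω i j) (mem_univ ω))
  have hsum : (∑ ω, α ω * penaltySum π ℓ (tw ω) e θ) + (us.map fun j => π (b j - ℓ j)).sum
      ≤ ∑ ω, α ω * penaltySum π ℓ (tw ω) e (θ ++ us) := by
    calc _ = ∑ ω, α ω * (penaltySum π ℓ (tw ω) e θ + (us.map fun j => π (b j - ℓ j)).sum) := by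
          simp only [mul_add, Finset.sum_add_distrib]
          rw [← Finset.sum_mul, hαsum, one_mul]
      _ ≤ _ := Finset.sum_le_sum fun ω _ => mul_le_mul_of_nonneg_left (hpen ω) (hα ω)
  have hopt : (us.map kv).sum ≤ ∑ j ∈ univ.erase (0 : V N), kv j * zbar j := by
    rw [← sum_erase_zero_mul_indicator kv husnd huscust]
    refine hzbaropt _ (fun j _ => ?_) (fun j hj => if_neg fun h => husdisj j h hj) ?_
    · split_ifs <;> norm_num
    · rw [sum_erase_zero_mul_indicator q husnd huscust]
      rw [load, List.map_append, List.sum_append] at hload'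
      rw [load]
      linarith
  have hkvsum : (us.map kv).sum = (us.map γ).sum - (us.map fun j => π (b j - ℓ j)).sum := by
    simp only [sum_map_eq_sum_range, ← Finset.sum_sub_distrib, hkv, hb]
  have hγ : ∀ l : List (V N), ∑ k : Fin l.length, γ (l.get k) = (l.map γ).sum := fun l =>
    Fin.sum_univ_fun_getElem l γ
  rw [redCost, hγ] at hbound ⊢
  rw [List.map_append, List.sum_append]
  linarith [cost_le_cost_append hc hθ' us]

end CSVRPTW
end

section
/- Let θ be a route ending at customer i, let j be a customer, and let π be a penalty function. Then for every scenario ω ∈ Ω, the arrival time at j along the extended route satisfies a_{θ⊕(j)}(j; t^ω) = s_θ(i; t^ω) + t^ω(i, j) ≥ τ_θ + min_{ω'∈Ω} t^{ω'}(i, j), and consequently Σ_{ω∈Ω} α^ω π(a_{θ⊕(j)}(j; t^ω) − ℓ(j)) ≥ π(τ_θ + min_{ω∈Ω} t^ω(i, j) − ℓ(j)). (The knapsack value bound: the negated knapsack value of customer j is a lower bound on the customer's contribution of expected penalty minus dual value to the reduced cost.) -/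
open Finset

namespace CSVRPTW

variable {N : ℕ} {Ω : Type*} [Fintype Ω] [Nonempty Ω]

theorem arrGo_append_singleton {N : ℕ} (t : V N → V N → ℝ) (e : V N → ℝ)
    (l : List (V N)) (p : V N) (a : ℝ) (j : V N) :
    arrGo t e p a (l ++ [j]) =
      max (e (l.getLastD p)) (arrGo t e p a l) + t (l.getLastD p) j := by
  induction l generalizing p a with
  | nil => rfl
  | cons v l ih =>
    rw [List.cons_append, List.getLastD_cons]
    exact ih v _

theorem arrLast_append_singleton {N : ℕ} (t : V N → V N → ℝ) (e : V N → ℝ)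
    {θ : List (V N)} (hθ : θ ≠ []) (j : V N) :
    arrLast t e (θ ++ [j]) = srvLast t e θ + t (θ.getLastD 0) j := by
  cases θ with
  | nil => exact absurd rfl hθ
  | cons v l =>
    rw [srvLast, List.getLastD_cons]
    exact arrGo_append_singleton t e l v _ j

/-- **Knapsack value bound**: for a route `θ` ending at customer `i` and a customer `j`,
in every scenario the arrival time at `j` along `θ ⊕ (j)` equals `s_θ(i; t^ω) + t^ω(i,j)`
and is at least `τ_θ + min_{ω'} t^{ω'}(i,j)`; consequently the weighted expected penalty at
`j` is at least `π(τ_θ + min_ω t^ω(i,j) − ℓ(j))`. -/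
theorem knapsack_value_bound
    {N : ℕ} {Ω : Type*} [Fintype Ω] [Nonempty Ω]
    (π : ℝ → ℝ) (e ℓ : V N → ℝ)
    (α : Ω → ℝ) (tw : Ω → V N → V N → ℝ)
    (hπmono : Monotone π) (hπzero : ∀ u : ℝ, u ≤ 0 → π u = 0)
    (hα : ∀ ω : Ω, 0 ≤ α ω) (hαsum : ∑ ω : Ω, α ω = 1)
    (θ : List (V N)) (i : V N)
    (hθ : IsRoute θ) (hi : i ≠ 0) (hlast : θ.getLastD 0 = i)
    (j : V N) (hj : j ≠ 0) :
    (∀ ω : Ω, arrLast (tw ω) e (θ ++ [j]) = srvLast (tw ω) e θ + tw ω i j) ∧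
    (∀ ω : Ω, tau tw e θ + (univ.inf' univ_nonempty fun ω' => tw ω' i j)
      ≤ arrLast (tw ω) e (θ ++ [j])) ∧
    π (tau tw e θ + (univ.inf' univ_nonempty fun ω' => tw ω' i j) - ℓ j)
      ≤ ∑ ω : Ω, α ω * π (arrLast (tw ω) e (θ ++ [j]) - ℓ j) := by
  have harr : ∀ ω : Ω, arrLast (tw ω) e (θ ++ [j]) = srvLast (tw ω) e θ + tw ω i j :=
    fun ω => hlast ▸ arrLast_append_singleton (tw ω) e hθ.1 j
  have hle : ∀ ω : Ω, tau tw e θ + (univ.inf' univ_nonempty fun ω' => tw ω' i j)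
      ≤ arrLast (tw ω) e (θ ++ [j]) := fun ω => by
    rw [harr ω]
    exact add_le_add (inf'_le (fun ω => srvLast (tw ω) e θ) (mem_univ ω))
      (inf'_le (fun ω' => tw ω' i j) (mem_univ ω))
  refine ⟨harr, hle, ?_⟩
  rw [← one_mul (π _), ← hαsum, sum_mul]
  exact sum_le_sum fun ω _ =>
    mul_le_mul_of_nonneg_left (hπmono (sub_le_sub_right (hle ω) _)) (hα ω)

end CSVRPTW
end
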